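/- There is no free ℤ-module L of finite rank with a symmetric ℤ-valued bilinear form B that is even (B(x,x) ∈ 2ℤ for all x ∈ L), containing submodules S and T with all of the following properties: S and T are primitive (L/S and L/T torsion-free) and mutually orthogonal (B(s,t) = 0 for all s ∈ S, t ∈ T); S is free with basis u₁, u₂ satisfying B(u₁,u₁) = B(u₂,u₂) = 0, B(u₁,u₂) = 6; T is free with basis t₁, t₂ satisfying B(t₁,t₁) = B(t₂,t₂) = 20, B(t₁,t₂) = 0; and the quotient L/(S + T) has cardinality 4 with every element x satisfying 2x = 0 (i.e. L/(S+T) ≅ (ℤ/2)⊕²). -/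

import Mathlib

/-- If `z + z` is twice an element of `S` plus an element of the primitive submodule `T`, then
`z ∈ S ⊔ T`. -/
theorem mem_sup_of_add_self_eq {L : Type*} [AddCommGroup L] {S T : Submodule ℤ L}
    (hTprim : ∀ (x : L) (n : ℤ), n ≠ 0 → n • x ∈ T → x ∈ T)
    {z s t : L} (hs : s ∈ S) (ht : t ∈ T) (h : z + z = (2 : ℤ) • s + t) : z ∈ S ⊔ T := by
  have hzs : z - s ∈ T := by
    refine hTprim _ 2 two_ne_zero ?_
    have : (2 : ℤ) • (z - s) = t := by
      rw [smul_sub, two_smul ℤ z, h]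
      abel
    rwa [this]
  have := add_mem (Submodule.mem_sup_left (T := T) hs) (Submodule.mem_sup_right (S := S) hzs)
  rwa [add_sub_cancel] at this

/-- The norm of a vector of the even lattice whose double has coordinates `(a, b, c, d)` in
`U(6) ⊕ diag(20, 20)` forces a parity condition on the coordinates. -/
theorem two_dvd_mul_add_add_of_add_self_eq {L : Type*} [AddCommGroup L]
    (B : LinearMap.BilinForm ℤ L) (hsymm : ∀ x y, B x y = B y x) (heven : ∀ x : L, 2 ∣ B x x)
    {u₁ u₂ t₁ t₂ : L} (hu₁ : B u₁ u₁ = 0) (hu₂ : B u₂ u₂ = 0) (hu : B u₁ u₂ = 6)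
    (ht₁ : B t₁ t₁ = 20) (ht₂ : B t₂ t₂ = 20) (ht : B t₁ t₂ = 0)
    (h₁₁ : B u₁ t₁ = 0) (h₁₂ : B u₁ t₂ = 0) (h₂₁ : B u₂ t₁ = 0) (h₂₂ : B u₂ t₂ = 0)
    {z : L} {a b c d : ℤ} (h : z + z = a • u₁ + b • u₂ + (c • t₁ + d • t₂)) :
    2 ∣ a * b + c + d := by
  have hB : B (z + z) (z + z) = 12 * (a * b) + 20 * (c * c + d * d) := by
    rw [h]
    simp only [map_add, map_smul, LinearMap.add_apply, LinearMap.smul_apply, smul_eq_mul,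
      hsymm u₂ u₁, hsymm t₂ t₁, hsymm t₁ u₁, hsymm t₁ u₂, hsymm t₂ u₁, hsymm t₂ u₂,
      hu₁, hu₂, hu, ht₁, ht₂, ht, h₁₁, h₁₂, h₂₁, h₂₂]
    ring
  simp only [map_add, LinearMap.add_apply] at hB
  obtain ⟨k, hk⟩ := heven z
  obtain ⟨m, hm⟩ := (Int.even_mul_pred_self c).two_dvd
  obtain ⟨n, hn⟩ := (Int.even_mul_pred_self d).two_dvd
  rw [mul_sub, mul_one] at hm hn
  omega

/-- In `(ℤ/2)⁴` there are no two vectors such that they and their difference are nonzero in both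
halves and satisfy `ab + c + d = 0`. -/
theorem not_parity_pair (a b c d a' b' c' d' : ℤ)
    (h₁ : ¬(2 ∣ a ∧ 2 ∣ b)) (h₂ : ¬(2 ∣ c ∧ 2 ∣ d)) (h₃ : 2 ∣ a * b + c + d)
    (h₁' : ¬(2 ∣ a' ∧ 2 ∣ b')) (h₂' : ¬(2 ∣ c' ∧ 2 ∣ d')) (h₃' : 2 ∣ a' * b' + c' + d')
    (k₁ : ¬(2 ∣ a - a' ∧ 2 ∣ b - b')) (k₂ : ¬(2 ∣ c - c' ∧ 2 ∣ d - d'))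
    (k₃ : 2 ∣ (a - a') * (b - b') + (c - c') + (d - d')) : False := by
  have key : ∀ n : ℤ, 2 ∣ n ↔ (n : ZMod 2) = 0 := fun n ↦
    (ZMod.intCast_zmod_eq_zero_iff_dvd n 2).symm
  simp only [key, Int.cast_add, Int.cast_mul, Int.cast_sub] at *
  generalize (a : ZMod 2) = a, (b : ZMod 2) = b, (c : ZMod 2) = c, (d : ZMod 2) = d,
    (a' : ZMod 2) = a', (b' : ZMod 2) = b', (c' : ZMod 2) = c', (d' : ZMod 2) = d' at *
  clear key
  revert a b c d a' b' c' d'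
  set_option synthInstance.maxSize 1000 in
  decide +kernel

/-- Lemma 3.7: there is no even lattice `L` containing primitive mutually
orthogonal sublattices `S ≅ U(6)` (with basis `u₁, u₂` of Gram matrix
`[[0,6],[6,0]]`) and `T` (with basis `t₁, t₂` of Gram matrix `diag(20, 20)`)
such that `L/(S + T) ≅ (ℤ/2)⊕²` (of order 4). -/
theorem stmt_15 (L : Type) [AddCommGroup L] [Module ℤ L]
    [Module.Free ℤ L] [Module.Finite ℤ L]
    (B : LinearMap.BilinForm ℤ L)
    (hsymm : ∀ x y, B x y = B y x)
    (heven : ∀ x : L, 2 ∣ B x x)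
    (S T : Submodule ℤ L)
    (hSprim : ∀ (x : L) (n : ℤ), n ≠ 0 → n • x ∈ S → x ∈ S)
    (hTprim : ∀ (x : L) (n : ℤ), n ≠ 0 → n • x ∈ T → x ∈ T)
    (horth : ∀ s ∈ S, ∀ t ∈ T, B s t = 0)
    (u₁ u₂ : L) (hu₁ : u₁ ∈ S) (hu₂ : u₂ ∈ S)
    (hSspan : S = Submodule.span ℤ ({u₁, u₂} : Set L))
    (hSind : LinearIndependent ℤ ![u₁, u₂])
    (hBu11 : B u₁ u₁ = 0) (hBu22 : B u₂ u₂ = 0) (hBu12 : B u₁ u₂ = 6)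
    (t₁ t₂ : L) (ht₁ : t₁ ∈ T) (ht₂ : t₂ ∈ T)
    (hTspan : T = Submodule.span ℤ ({t₁, t₂} : Set L))
    (hTind : LinearIndependent ℤ ![t₁, t₂])
    (hB11 : B t₁ t₁ = 20) (hB22 : B t₂ t₂ = 20) (hB12 : B t₁ t₂ = 0)
    (hcard : Nat.card (L ⧸ (S ⊔ T)) = 4)
    (h2elem : ∀ x : L ⧸ (S ⊔ T), x + x = 0) :
    False := by
  obtain rfl : ‹Module ℤ L› = AddCommGroup.toIntModule L := Subsingleton.elim _ _
  have hcoord (z : L) : ∃ a b c d : ℤ, z + z = a • u₁ + b • u₂ + (c • t₁ + d • t₂) := by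
    have hz : z + z ∈ S ⊔ T := by
      rw [← Submodule.Quotient.mk_eq_zero, Submodule.Quotient.mk_add]
      exact h2elem _
    obtain ⟨s, hs, t, ht, hst⟩ := Submodule.mem_sup.1 hz
    rw [hSspan, Submodule.mem_span_pair] at hs
    rw [hTspan, Submodule.mem_span_pair] at ht
    obtain ⟨a, b, rfl⟩ := hs
    obtain ⟨c, d, rfl⟩ := ht
    exact ⟨a, b, c, d, hst.symm⟩
  have hparity (z : L) (a b c d : ℤ) (h : z + z = a • u₁ + b • u₂ + (c • t₁ + d • t₂))
      (hz : z ∉ S ⊔ T) : ¬(2 ∣ a ∧ 2 ∣ b) ∧ ¬(2 ∣ c ∧ 2 ∣ d) ∧ 2 ∣ a * b + c + d := by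
    refine ⟨?_, ?_, two_dvd_mul_add_add_of_add_self_eq B hsymm heven hBu11 hBu22 hBu12 hB11 hB22
      hB12 (horth _ hu₁ _ ht₁) (horth _ hu₁ _ ht₂) (horth _ hu₂ _ ht₁) (horth _ hu₂ _ ht₂) h⟩
    · rintro ⟨⟨a, rfl⟩, ⟨b, rfl⟩⟩
      refine hz (mem_sup_of_add_self_eq hTprim
        (add_mem (S.smul_mem a hu₁) (S.smul_mem b hu₂))
        (add_mem (T.smul_mem c ht₁) (T.smul_mem d ht₂)) ?_)
      rw [h, smul_add, smul_smul, smul_smul]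
    · rintro ⟨⟨c, rfl⟩, ⟨d, rfl⟩⟩
      rw [sup_comm] at hz
      refine hz (mem_sup_of_add_self_eq hSprim
        (add_mem (T.smul_mem c ht₁) (T.smul_mem d ht₂))
        (add_mem (S.smul_mem a hu₁) (S.smul_mem b hu₂)) ?_)
      rw [h, smul_add, smul_smul, smul_smul, add_comm]
  have : Finite (L ⧸ (S ⊔ T)) := Nat.finite_of_card_ne_zero (by omega)
  have : Fintype (L ⧸ (S ⊔ T)) := Fintype.ofFinite _
  obtain ⟨p, q, r, hpq, hpr, hqr⟩ := Fintype.two_lt_card_iff.1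
    (show 2 < Fintype.card (L ⧸ (S ⊔ T)) by rw [← Nat.card_eq_fintype_card]; omega)
  obtain ⟨x, rfl⟩ := Submodule.Quotient.mk_surjective _ p
  obtain ⟨y, rfl⟩ := Submodule.Quotient.mk_surjective _ q
  obtain ⟨w, rfl⟩ := Submodule.Quotient.mk_surjective _ r
  rw [Ne, Submodule.Quotient.eq] at hpq hpr hqr
  obtain ⟨a, b, c, d, hx⟩ := hcoord (x - w)
  obtain ⟨a', b', c', d', hy⟩ := hcoord (y - w)
  obtain ⟨h₁, h₂, h₃⟩ := hparity _ _ _ _ _ hx hpr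
  obtain ⟨h₁', h₂', h₃'⟩ := hparity _ _ _ _ _ hy hqr
  have hxy : (x - y) + (x - y) = (a - a') • u₁ + (b - b') • u₂
      + ((c - c') • t₁ + (d - d') • t₂) := by
    have : (x - y) + (x - y) = ((x - w) + (x - w)) - ((y - w) + (y - w)) := by abel
    rw [this, hx, hy]
    simp only [sub_smul]
    abel
  obtain ⟨k₁, k₂, k₃⟩ := hparity _ _ _ _ _ hxy hpq
  exact not_parity_pair a b c d a' b' c' d' h₁ h₂ h₃ h₁' h₂' h₃' k₁ k₂ k₃
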